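/- For {z,z'} = {x,y} and α ∈ L_B, the reduction schema (R10) is valid on k-sight models: [z]K_{z'}α ↔ ⋀_{T,T1⊆Cons}(Rz=T ∧ K_{z'}z=T1 → (⋀_{t∈T}α[t/z]) ∧ ((⋀_{t∈T}D^k z' t) ∨ ⋀_{t1∈T1, t2∈Cons}(Rt1t2 ∧ ¬D^k z' t2 → α[t2/z]))) holds at every situation of every k-sight model. -/

import Mathlib

/-! Core definitions for the Epistemic Logic of Cops and Robbers (ELCR). -/

/-- The two players/variables. -/
inductive Var : Type
  | x | y
  deriving DecidableEq

/-- The other variable. -/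
def Var.other : Var → Var
  | .x => .y
  | .y => .x

/-- Terms: constants or variables. -/
inductive Term (Cons : Type) : Type
  | const (c : Cons)
  | var (v : Var)
  deriving DecidableEq

/-- Formulas of the full language `L` (with movement modalities). -/
inductive Form (Pred Cons : Type) : Type
  | pred (P : Pred) (args : List (Term Cons))
  | rel (t₁ t₂ : Term Cons)
  | eq (t₁ t₂ : Term Cons)
  | neg (φ : Form Pred Cons)
  | and (φ ψ : Form Pred Cons)
  | Kt (z : Var) (t : Term Cons)
  | K (z : Var) (φ : Form Pred Cons)
  | box (z : Var) (φ : Form Pred Cons)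

namespace Form

variable {Pred Cons : Type}

def imp (φ ψ : Form Pred Cons) : Form Pred Cons := .neg (.and φ (.neg ψ))
def or (φ ψ : Form Pred Cons) : Form Pred Cons := .neg (.and (.neg φ) (.neg ψ))
def iffF (φ ψ : Form Pred Cons) : Form Pred Cons := .and (imp φ ψ) (imp ψ φ)
def falseF : Form Pred Cons := .neg (.eq (.var .x) (.var .x))
def trueF : Form Pred Cons := .neg falseF
/-- `⟨K_z⟩φ := ¬K_z¬φ`. -/
def diaK (z : Var) (φ : Form Pred Cons) : Form Pred Cons := .neg (.K z (.neg φ))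

def bigAnd : List (Form Pred Cons) → Form Pred Cons
  | [] => trueF
  | φ :: l => .and φ (bigAnd l)

def bigOr : List (Form Pred Cons) → Form Pred Cons
  | [] => falseF
  | φ :: l => or φ (bigOr l)

/-- Membership in the Boolean base language `L_B`. -/
def isBase : Form Pred Cons → Prop
  | .pred _ _ => True
  | .rel _ _ => True
  | .eq _ _ => True
  | .neg φ => isBase φ
  | .and φ ψ => isBase φ ∧ isBase ψ
  | .Kt _ _ => False
  | .K _ _ => False
  | .box _ _ => False

/-- Membership in `L_BD` (Booleans plus movement modalities). -/
def isBD : Form Pred Cons → Prop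
  | .pred _ _ => True
  | .rel _ _ => True
  | .eq _ _ => True
  | .neg φ => isBD φ
  | .and φ ψ => isBD φ ∧ isBD ψ
  | .Kt _ _ => False
  | .K _ _ => False
  | .box _ φ => isBD φ

/-- Membership in the full language `L`. -/
def isL : Form Pred Cons → Prop
  | .pred _ _ => True
  | .rel _ _ => True
  | .eq _ _ => True
  | .neg φ => isL φ
  | .and φ ψ => isL φ ∧ isL ψ
  | .Kt _ _ => True
  | .K _ ψ => isBD ψ
  | .box _ φ => isL φ

/-- Membership in the static fragment `L⁻`: no movement modalities, and the
knowledge operator `K_z` is applied to `L_B`-formulas only. -/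
def isStatic : Form Pred Cons → Prop
  | .pred _ _ => True
  | .rel _ _ => True
  | .eq _ _ => True
  | .neg φ => isStatic φ
  | .and φ ψ => isStatic φ ∧ isStatic ψ
  | .Kt _ _ => True
  | .K _ φ => isBase φ
  | .box _ _ => False

/-- The variable `z` occurs in the formula. -/
def occurs (z : Var) : Form Pred Cons → Prop
  | .pred _ args => Term.var z ∈ args
  | .rel t₁ t₂ => t₁ = Term.var z ∨ t₂ = Term.var z
  | .eq t₁ t₂ => t₁ = Term.var z ∨ t₂ = Term.var z
  | .neg φ => occurs z φ
  | .and φ ψ => occurs z φ ∨ occurs z ψ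
  | .Kt w t => w = z ∨ t = Term.var z
  | .K w φ => w = z ∨ occurs z φ
  | .box w φ => w = z ∨ occurs z φ

/-- The list of terms occurring in a formula. -/
def termList : Form Pred Cons → List (Term Cons)
  | .pred _ args => args
  | .rel t₁ t₂ => [t₁, t₂]
  | .eq t₁ t₂ => [t₁, t₂]
  | .neg φ => termList φ
  | .and φ ψ => termList φ ++ termList ψ
  | .Kt _ t => [t]
  | .K _ φ => termList φ
  | .box _ φ => termList φ

end Form

/-- Substituting the constant `c` for the variable `z` in a term. -/
def Term.substC {Cons : Type} (c : Cons) (z : Var) : Term Cons → Term Cons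
  | .var v => if v = z then .const c else .var v
  | .const c' => .const c'

/-- `φ.substC c z` is `φ[c/z]`. -/
def Form.substC {Pred Cons : Type} (c : Cons) (z : Var) : Form Pred Cons → Form Pred Cons
  | .pred P args => .pred P (args.map (Term.substC c z))
  | .rel t₁ t₂ => .rel (t₁.substC c z) (t₂.substC c z)
  | .eq t₁ t₂ => .eq (t₁.substC c z) (t₂.substC c z)
  | .neg φ => .neg (φ.substC c z)
  | .and φ ψ => .and (φ.substC c z) (ψ.substC c z)
  | .Kt w t => .Kt w (t.substC c z)
  | .K w φ => .K w (φ.substC c z)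
  | .box w φ => .box w (φ.substC c z)

/-- Replacing the term `t₂` by the term `t₁`. -/
def Term.repl {Cons : Type} [DecidableEq Cons] (t₁ t₂ t : Term Cons) : Term Cons :=
  if t = t₂ then t₁ else t

/-- `φ.replace t₁ t₂` is `φ[t₁/t₂]`: the result of replacing `t₂` in `φ` with `t₁`. -/
def Form.replace {Pred Cons : Type} [DecidableEq Cons] (t₁ t₂ : Term Cons) :
    Form Pred Cons → Form Pred Cons
  | .pred P args => .pred P (args.map (Term.repl t₁ t₂))
  | .rel s₁ s₂ => .rel (Term.repl t₁ t₂ s₁) (Term.repl t₁ t₂ s₂)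
  | .eq s₁ s₂ => .eq (Term.repl t₁ t₂ s₁) (Term.repl t₁ t₂ s₂)
  | .neg φ => .neg (φ.replace t₁ t₂)
  | .and φ ψ => .and (φ.replace t₁ t₂) (ψ.replace t₁ t₂)
  | .Kt w t => .Kt w (Term.repl t₁ t₂ t)
  | .K w φ => .K w (φ.replace t₁ t₂)
  | .box w φ => .box w (φ.replace t₁ t₂)

/-- The list of all terms (constants and variables), for finite `Cons`. -/
noncomputable def allTerms (Cons : Type) [Fintype Cons] : List (Term Cons) :=
  (Finset.univ : Finset Cons).toList.map Term.const ++ [Term.var .x, Term.var .y]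

/-- The syntactic distance formulas `D^n t₁ t₂`. -/
noncomputable def distForm (Pred : Type) {Cons : Type} [Fintype Cons] :
    ℕ → Term Cons → Term Cons → Form Pred Cons
  | 0, t₁, t₂ => .eq t₁ t₂
  | n + 1, t₁, t₂ =>
      Form.or (distForm Pred n t₁ t₂)
        (Form.bigOr ((allTerms Cons).map fun t =>
          Form.and (distForm Pred n t₁ t) (Form.or (.rel t t₂) (.rel t₂ t))))

/-- `K_z z' = T`: the set `T` consists of the possible positions of `z'` considered by `z`. -/
noncomputable def KzEqSet {Pred Cons : Type} [Fintype Cons] [DecidableEq Cons]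
    (z z' : Var) (T : Finset Cons) : Form Pred Cons :=
  Form.bigAnd
    ((T.toList.map fun c => Form.diaK z (.eq (.var z') (.const c))) ++
      (Tᶜ.toList.map fun c => Form.K z (.neg (.eq (.var z') (.const c)))))

/-- `Rz = T`: `T` is exactly the set of (names of) R-successors of `z`. -/
noncomputable def RzEqSet {Pred Cons : Type} [Fintype Cons] [DecidableEq Cons]
    (z : Var) (T : Finset Cons) : Form Pred Cons :=
  Form.bigAnd
    ((T.toList.map fun c => Form.rel (.var z) (.const c)) ++
      (Tᶜ.toList.map fun c => Form.neg (Form.rel (.var z) (.const c))))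

/-- The list of all subsets of `Cons`. -/
noncomputable def powList (Cons : Type) [Fintype Cons] [DecidableEq Cons] : List (Finset Cons) :=
  (Finset.univ : Finset Cons).powerset.toList

/-! ### Semantics -/

/-- An interpretation of the vocabulary over a domain `D`. -/
structure Interp (Pred Cons D : Type) where
  pred : Pred → List D → Prop
  rel : D → D → Prop
  const : Cons → D

/-- Assignments (situations): positions of the two players. -/
abbrev Assign (D : Type) := Var → D

/-- The value of a term at an interpretation and a situation. -/
def Term.val {Pred Cons D : Type} (I : Interp Pred Cons D) (σ : Assign D) :
    Term Cons → D
  | .const c => I.const c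
  | .var v => σ v

/-- `Dball I m s` is `D^m(s)`: points reachable from `s` in at most `m` steps
along `I.rel` or its converse. -/
def Dball {Pred Cons D : Type} (I : Interp Pred Cons D) : ℕ → D → Set D
  | 0, s => {s}
  | m + 1, s => Dball I m s ∪ {t | ∃ u ∈ Dball I m s, I.rel u t ∨ I.rel t u}

/-- `R^z σ σ'`: player `z` moves along an arrow, the other player stays put. -/
def Rstep {Pred Cons D : Type} (I : Interp Pred Cons D) (z : Var) (σ σ' : Assign D) : Prop :=
  I.rel (σ z) (σ' z) ∧ σ z.other = σ' z.other

/-- Indistinguishability data: a relation on assignments for each player. -/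
abbrev SimRel (D : Type) := Var → Assign D → Assign D → Prop

/-- `Σ|σ`: the situations related to `σ` by some player's indistinguishability. -/
def restrict {D : Type} (Sit : Set (Assign D)) (sim : SimRel D) (σ : Assign D) :
    Set (Assign D) :=
  {σ' ∈ Sit | ∃ z, sim z σ σ'}

/-- The updated set of situations after player `z` moves from `σ₁` to `σ₂`. -/
def updSit {Pred Cons D : Type} (k : ℕ) (I : Interp Pred Cons D)
    (Sit : Set (Assign D)) (sim : SimRel D) (z : Var) (σ₁ σ₂ : Assign D) :
    Set (Assign D) :=
  {σ' | (σ₂ Var.x ∈ Dball I k (σ₂ Var.y) ∧ σ' = σ₂) ∨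
        (σ₂ Var.x ∉ Dball I k (σ₂ Var.y) ∧
          (∃ σ ∈ restrict Sit sim σ₁, Rstep I z σ σ') ∧
          σ' Var.x ∉ Dball I k (σ' Var.y))}

/-- The updated indistinguishability relations: `σ₁ ∼'_z σ₂` iff `σ₁ z = σ₂ z`. -/
def updSim (D : Type) : SimRel D := fun z σ₁ σ₂ => σ₁ z = σ₂ z

/-- Satisfaction for `ELCR` (with sight `k`). -/
def Sat {Pred Cons D : Type} (k : ℕ) (I : Interp Pred Cons D) :
    Set (Assign D) → SimRel D → Assign D → Form Pred Cons → Prop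
  | _, _, σ, .pred P args => I.pred P (args.map (Term.val I σ))
  | _, _, σ, .rel t₁ t₂ => I.rel (t₁.val I σ) (t₂.val I σ)
  | _, _, σ, .eq t₁ t₂ => t₁.val I σ = t₂.val I σ
  | Sit, sim, σ, .neg φ => ¬ Sat k I Sit sim σ φ
  | Sit, sim, σ, .and φ ψ => Sat k I Sit sim σ φ ∧ Sat k I Sit sim σ ψ
  | Sit, sim, σ, .Kt z t => ∀ σ' ∈ Sit, sim z σ' σ → t.val I σ = t.val I σ'
  | Sit, sim, σ, .K z φ => ∀ σ' ∈ Sit, sim z σ' σ → Sat k I Sit sim σ' φ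
  | Sit, sim, σ, .box z φ => ∀ σ₂, Rstep I z σ σ₂ →
      Sat k I (updSit k I Sit sim z σ σ₂) (updSim D) σ₂ φ

/-- The conditions making `(D, I, Σ, ∼)` a model: seriality of `I.rel`, every
point named by a constant, `Σ` nonempty, and each `∼_z` an equivalence relation on `Σ`. -/
structure IsModel {Pred Cons D : Type} (I : Interp Pred Cons D)
    (Sit : Set (Assign D)) (sim : SimRel D) : Prop where
  serial : ∀ s, ∃ t, I.rel s t
  const_surj : Function.Surjective I.const
  nonempty : Sit.Nonempty
  sim_mem : ∀ z σ σ', sim z σ σ' → σ ∈ Sit ∧ σ' ∈ Sit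
  sim_refl : ∀ z, ∀ σ ∈ Sit, sim z σ σ
  sim_symm : ∀ z σ σ', sim z σ σ' → sim z σ' σ
  sim_trans : ∀ z σ₁ σ₂ σ₃, sim z σ₁ σ₂ → sim z σ₂ σ₃ → sim z σ₁ σ₃

/-- The `k`-sight condition. -/
def KSight {Pred Cons D : Type} (k : ℕ) (I : Interp Pred Cons D)
    (Sit : Set (Assign D)) (sim : SimRel D) : Prop :=
  ∀ z σ σ', σ ∈ Sit → σ' ∈ Sit → sim z σ σ' →
    ∀ z', σ z' ∈ Dball I k (σ z) → σ z' = σ' z'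

/-- A nonempty conjunction `K_zα₁ ∧ ⋯ ∧ K_zαₙ ∧ ⟨K_z⟩β₁ ∧ ⋯ ∧ ⟨K_z⟩βₘ`. -/
def kConj {Pred Cons : Type} (z : Var) (αs βs : List (Form Pred Cons)) :
    Form Pred Cons :=
  Form.bigAnd (αs.map (Form.K z) ++ βs.map (Form.diaK z))
/-- The right-hand side of the reduction axiom (R10). -/
noncomputable def r10rhs (Pred : Type) {Cons : Type} [Fintype Cons] [DecidableEq Cons]
    (k : ℕ) (z : Var) (α : Form Pred Cons) : Form Pred Cons :=
  Form.bigAnd ((powList Cons).flatMap fun T => (powList Cons).map fun T₁ =>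
    ((RzEqSet z T).and (KzEqSet z.other z T₁)).imp
      ((Form.bigAnd (T.toList.map fun t => α.substC t z)).and
        (Form.or
          (Form.bigAnd (T.toList.map fun t =>
            distForm Pred k (Term.var z.other) (Term.const t)))
          (Form.bigAnd (T₁.toList.flatMap fun t₁ =>
            (Finset.univ : Finset Cons).toList.map fun t₂ =>
              ((Form.rel (Term.const t₁) (Term.const t₂)).and
                  (Form.neg (distForm Pred k (Term.var z.other) (Term.const t₂)))).imp
                (α.substC t₂ z))))))

theorem dball_succ_of_adj {Pred Cons D : Type} (I : Interp Pred Cons D) {s u : D}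
    (hsu : I.rel s u ∨ I.rel u s) (m : ℕ) {t : D} (ht : t ∈ Dball I m u) :
    t ∈ Dball I (m + 1) s := by
  induction m generalizing t with
  | zero =>
    obtain rfl : t = u := ht
    exact Or.inr ⟨s, rfl, hsu⟩
  | succ m ih =>
    rcases ht with ht | ⟨v, hv, hvt⟩
    · exact Or.inl (ih ht)
    · exact Or.inr ⟨v, ih hv, hvt⟩

theorem dball_symm {Pred Cons D : Type} (I : Interp Pred Cons D) (m : ℕ) {s t : D}
    (h : t ∈ Dball I m s) : s ∈ Dball I m t := by
  induction m generalizing t with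
  | zero => exact Eq.symm h
  | succ m ih =>
    rcases h with h | ⟨u, hu, hut⟩
    · exact Or.inl (ih h)
    · exact dball_succ_of_adj I hut.symm m (ih hu)

theorem self_mem_dball {Pred Cons D : Type} (I : Interp Pred Cons D) (m : ℕ) (s : D) :
    s ∈ Dball I m s := by
  induction m with
  | zero => exact rfl
  | succ m ih => exact Or.inl ih

theorem x_mem_dball_y_iff {Pred Cons D : Type} (I : Interp Pred Cons D) (k : ℕ) (z : Var)
    (σ : Assign D) : σ .x ∈ Dball I k (σ .y) ↔ σ z ∈ Dball I k (σ z.other) := by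
  cases z
  · exact Iff.rfl
  · exact ⟨dball_symm I k, dball_symm I k⟩

theorem assign_eq_of_apply_eq {D : Type} (z : Var) {σ τ : Assign D} (h : σ z = τ z)
    (h' : σ z.other = τ z.other) : σ = τ := by
  funext v
  cases z <;> cases v <;> assumption

theorem other_ne (z : Var) : z.other ≠ z := by
  cases z <;> simp [Var.other]

section Sat

variable {Pred Cons D : Type} (k : ℕ) (I : Interp Pred Cons D) (Sit : Set (Assign D))
  (sim : SimRel D) (σ : Assign D)

theorem sat_or (φ ψ : Form Pred Cons) : Sat k I Sit sim σ (φ.or ψ) ↔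
    Sat k I Sit sim σ φ ∨ Sat k I Sit sim σ ψ := by
  simp only [Form.or, Sat]
  tauto

theorem sat_imp (φ ψ : Form Pred Cons) : Sat k I Sit sim σ (φ.imp ψ) ↔
    (Sat k I Sit sim σ φ → Sat k I Sit sim σ ψ) := by
  simp only [Form.imp, Sat]
  tauto

theorem sat_bigAnd (l : List (Form Pred Cons)) : Sat k I Sit sim σ (Form.bigAnd l) ↔
    ∀ φ ∈ l, Sat k I Sit sim σ φ := by
  induction l with
  | nil => simp [Form.bigAnd, Form.trueF, Form.falseF, Sat]
  | cons φ l ih => simp [Form.bigAnd, Sat, ih]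

theorem sat_bigOr (l : List (Form Pred Cons)) : Sat k I Sit sim σ (Form.bigOr l) ↔
    ∃ φ ∈ l, Sat k I Sit sim σ φ := by
  induction l with
  | nil => simp [Form.bigOr, Form.falseF, Sat]
  | cons φ l ih => simp [Form.bigOr, sat_or, ih]

theorem sat_distForm [Fintype Cons] (hI : Function.Surjective I.const) (n : ℕ)
    (t₁ t₂ : Term Cons) : Sat k I Sit sim σ (distForm Pred n t₁ t₂) ↔
      t₂.val I σ ∈ Dball I n (t₁.val I σ) := by
  induction n generalizing t₂ with
  | zero => exact eq_comm
  | succ n ih =>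
    simp only [distForm, sat_or, sat_bigOr, List.mem_map, Dball, Set.mem_union,
      Set.mem_ofPred_eq, ih]
    refine or_congr_right ⟨?_, ?_⟩
    · rintro ⟨_, ⟨t, -, rfl⟩, ht, h⟩
      exact ⟨t.val I σ, (ih t).1 ht, (sat_or ..).1 h⟩
    · rintro ⟨u, hu, h⟩
      obtain ⟨c, rfl⟩ := hI u
      exact ⟨_, ⟨.const c, by simp [allTerms], rfl⟩, (ih _).2 hu, (sat_or ..).2 h⟩

theorem sat_congr_of_isBase {α : Form Pred Cons} (hα : α.isBase) (Sit' : Set (Assign D))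
    (sim' : SimRel D) : Sat k I Sit sim σ α ↔ Sat k I Sit' sim' σ α := by
  induction α with
  | pred | rel | eq => exact Iff.rfl
  | neg φ ih => exact not_congr (ih hα)
  | and φ ψ ih₁ ih₂ => exact and_congr (ih₁ hα.1) (ih₂ hα.2)
  | Kt | K | box => exact hα.elim

theorem val_substC (c : Cons) (z : Var) (t : Term Cons) :
    (t.substC c z).val I σ = t.val I (Function.update σ z (I.const c)) := by
  cases t with
  | const => rfl
  | var v =>
    by_cases h : v = z
    · subst h; simp [Term.substC, Term.val]
    · simp [Term.substC, Term.val, h]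

theorem sat_substC_of_isBase {α : Form Pred Cons} (hα : α.isBase) (c : Cons) (z : Var) :
    Sat k I Sit sim σ (α.substC c z) ↔
      Sat k I Sit sim (Function.update σ z (I.const c)) α := by
  induction α with
  | pred P args =>
    have h : Term.val I σ ∘ Term.substC c z =
        Term.val I (Function.update σ z (I.const c)) := funext (val_substC I σ c z)
    simp [Form.substC, Sat, h]
  | rel | eq => simp [Form.substC, Sat, val_substC]
  | neg φ ih => exact not_congr (ih hα)
  | and φ ψ ih₁ ih₂ => exact and_congr (ih₁ hα.1) (ih₂ hα.2)
  | Kt | K | box => exact hα.elim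

theorem sat_RzEqSet [Fintype Cons] [DecidableEq Cons] (z : Var) (T : Finset Cons) :
    Sat k I Sit sim σ (RzEqSet z T) ↔ ∀ c, c ∈ T ↔ I.rel (σ z) (I.const c) := by
  simp only [RzEqSet, sat_bigAnd, List.mem_append, or_imp, forall_and, List.forall_mem_map,
    Finset.mem_toList, Finset.mem_compl, Sat, Term.val, iff_def, not_imp_not]

theorem sat_KzEqSet [Fintype Cons] [DecidableEq Cons] (z z' : Var) (T : Finset Cons) :
    Sat k I Sit sim σ (KzEqSet z z' T) ↔
      ∀ c, c ∈ T ↔ ∃ σ' ∈ Sit, sim z σ' σ ∧ σ' z' = I.const c := by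
  simp only [KzEqSet, Form.diaK, sat_bigAnd, List.mem_append, or_imp, forall_and,
    List.forall_mem_map, Finset.mem_toList, Finset.mem_compl, Sat, Term.val,
    iff_def (a := _ ∈ T)]
  refine and_congr ?_ ?_ <;> refine forall_congr' fun c => ?_
  · simp
  · rw [not_imp_comm]
    simp

theorem sat_r10rhs [Fintype Cons] [DecidableEq Cons] (hI : Function.Surjective I.const)
    (z : Var) {α : Form Pred Cons} (hα : α.isBase) :
    Sat k I Sit sim σ (r10rhs Pred k z α) ↔
      (∀ d, I.rel (σ z) d → Sat k I Sit sim (Function.update σ z d) α) ∧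
      ((∀ d, I.rel (σ z) d → d ∈ Dball I k (σ z.other)) ∨
        ∀ σ' ∈ Sit, sim z.other σ' σ → ∀ d, I.rel (σ' z) d → d ∉ Dball I k (σ z.other) →
          Sat k I Sit sim (Function.update σ z d) α) := by
  classical
  simp only [r10rhs, sat_bigAnd, List.forall_mem_flatMap, List.forall_mem_map, sat_imp, powList,
    Finset.mem_toList, Finset.mem_powerset, Finset.subset_univ, Finset.mem_univ, forall_const,
    Sat, sat_RzEqSet, sat_KzEqSet, sat_or, sat_distForm k I Sit sim σ hI, Term.val,
    sat_substC_of_isBase k I Sit sim σ hα, hI.forall]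
  constructor
  · intro h
    have h := h (Finset.univ.filter fun c => I.rel (σ z) (I.const c))
      (Finset.univ.filter fun c => ∃ σ' ∈ Sit, sim z.other σ' σ ∧ σ' z = I.const c) (by simp)
    simp only [Finset.mem_filter, Finset.mem_univ, true_and] at h
    refine ⟨h.1, h.2.imp_right fun h σ' hσ' hsim t₂ hr hd => ?_⟩
    obtain ⟨c, hc⟩ := hI (σ' z)
    exact h c ⟨σ', hσ', hsim, hc.symm⟩ t₂ ⟨hc ▸ hr, hd⟩
  · rintro ⟨h₁, h₂⟩ T T₁ ⟨hT, hT₁⟩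
    refine ⟨fun t ht => h₁ t ((hT t).1 ht), h₂.imp (fun h t ht => h t ((hT t).1 ht)) ?_⟩
    rintro h t₁ ht₁ t₂ ⟨hr, hd⟩
    obtain ⟨σ', hσ', hsim, hc⟩ := (hT₁ t₁).1 ht₁
    exact h σ' hσ' hsim t₂ (hc ▸ hr) hd

end Sat

/-- A situation indistinguishable from `σ` by some player and agreeing with `σ` on the position of
one player is indistinguishable from `σ` by that player. -/
theorem sim_of_mem_restrict {Pred Cons D : Type} {k : ℕ} {I : Interp Pred Cons D}
    {Sit : Set (Assign D)} {sim : SimRel D} (hM : IsModel I Sit sim) (hK : KSight k I Sit sim)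
    {σ τ : Assign D} (hτ : τ ∈ restrict Sit sim σ) (w : Var) (h : τ w = σ w) :
    sim w τ σ := by
  obtain ⟨hτS, v, hv⟩ := hτ
  have hσS := (hM.sim_mem v σ τ hv).1
  have hv' : σ v = τ v := hK v σ τ hσS hτS hv v (self_mem_dball I k _)
  by_cases hvw : v = w
  · subst hvw
    exact hM.sim_symm _ _ _ hv
  · have : τ = σ := by
      funext u
      cases u <;> cases v <;> cases w <;> simp_all
    subst this
    exact hM.sim_refl w τ hτS

/-- The reduction schema (R10) is valid on `k`-sight models:
`[z]K_{z'}α ↔ ⋀_{T,T₁⊆Cons}(Rz=T ∧ K_{z'}z=T₁ → (⋀_{t∈T}α[t/z]) ∧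
((⋀_{t∈T}D^k z' t) ∨ ⋀_{t₁∈T₁,t₂∈Cons}(Rt₁t₂ ∧ ¬D^k z' t₂ → α[t₂/z])))`. -/
theorem r10_valid {Pred Cons : Type} [Fintype Cons] [DecidableEq Cons]
    [Nonempty Cons] (k : ℕ) (D : Type) [Finite D] (I : Interp Pred Cons D)
    (Sit : Set (Assign D)) (sim : SimRel D)
    (hM : IsModel I Sit sim) (hK : KSight k I Sit sim)
    (σ : Assign D) (hσ : σ ∈ Sit) (z : Var)
    (α : Form Pred Cons) (hα : α.isBase) :
    Sat k I Sit sim σ (Form.box z (Form.K z.other α)) ↔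
      Sat k I Sit sim σ (r10rhs Pred k z α) := by
  rw [sat_r10rhs k I Sit sim σ hM.const_surj z hα]
  have move (τ : Assign D) (d : D) (hd : I.rel (τ z) d) : Rstep I z τ (Function.update τ z d) :=
    ⟨by simpa using hd, by simp [other_ne]⟩
  simp only [Sat, updSim]
  constructor
  · intro h
    have outside (d : D) (hd : I.rel (σ z) d) (hdk : d ∉ Dball I k (σ z.other)) :
        ∀ τ ∈ Sit, sim z.other τ σ → ∀ e, I.rel (τ z) e → e ∉ Dball I k (σ z.other) →
          Sat k I Sit sim (Function.update σ z e) α := by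
      intro τ hτ hsim e he hek
      have hτσ : τ z.other = σ z.other :=
        hK _ τ σ hτ hσ hsim _ (self_mem_dball I k _)
      have key := h _ (move σ d hd) (Function.update τ z e) (Or.inr ⟨?_, ⟨τ, ⟨hτ, z.other,
        hM.sim_symm _ _ _ hsim⟩, move τ e he⟩, ?_⟩) (by simpa [other_ne] using hτσ)
      · rw [assign_eq_of_apply_eq z (σ := Function.update τ z e)
          (τ := Function.update σ z e) (by simp)
          (by simpa [other_ne] using hτσ)] at key
        exact (sat_congr_of_isBase k I _ _ _ hα _ _).1 key
      · rw [x_mem_dball_y_iff I k z]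
        simpa [other_ne] using hdk
      · rw [x_mem_dball_y_iff I k z]
        simpa [other_ne, hτσ] using hek
    refine ⟨fun d hd => ?_, ?_⟩
    · by_cases hdk : d ∈ Dball I k (σ z.other)
      · refine (sat_congr_of_isBase k I _ _ _ hα _ _).1
          (h _ (move σ d hd) _ (Or.inl ⟨?_, rfl⟩) rfl)
        rw [x_mem_dball_y_iff I k z]
        simpa [other_ne] using hdk
      · exact outside d hd hdk σ hσ (hM.sim_refl _ σ hσ) d hd hdk
    · by_contra! hcon
      obtain ⟨⟨d, hd, hdk⟩, τ, hτ, hsim, e, he, hek, hα'⟩ := hcon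
      exact hα' (outside d hd hdk τ hτ hsim e he hek)
  · rintro ⟨h₁, h₂⟩ σ₂ hstep ρ hρ hρσ
    have hρ' : ρ = Function.update σ z (ρ z) :=
      assign_eq_of_apply_eq z (by simp) (by simpa [other_ne] using hρσ.trans hstep.2.symm)
    refine (sat_congr_of_isBase k I Sit sim _ hα _ _).1 ?_
    rw [hρ']
    rcases hρ with ⟨-, rfl⟩ | ⟨hfar, ⟨τ, hτ, hτρ⟩, hρfar⟩
    · exact h₁ _ hstep.1
    · rw [x_mem_dball_y_iff I k z] at hfar hρfar
      have hsim := sim_of_mem_restrict hM hK hτ z.other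
        (hτρ.2.trans (hρσ.trans hstep.2.symm))
      rw [hρσ, ← hstep.2] at hρfar
      rw [← hstep.2] at hfar
      rcases h₂ with h₂ | h₂
      · exact absurd (h₂ _ hstep.1) hfar
      · exact h₂ τ hτ.1 hsim _ hτρ.1 hρfar
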